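/- Let [X_{n,j}]_{n≥1, j=1,…,M} (M finite or infinite) be an array of random variables with values in a Polish space that is partially exchangeable in the sense of de Finetti, with law P. Then: (i) as n_1,…,n_M → ∞, the vector of the marginal empirical distributions (F̂_{n_1},…,F̂_{n_M}) converges weakly, P-a.s., to a vector of random probability measures (F̃_1,…,F̃_M); (ii) for all n_1,…,n_M ≥ 1 and measurable sets A_{i,j}, P(∩_{j=1}^M (X_{1,j}∈A_{1,j},…,X_{n_j,j}∈A_{n_j,j})) = ∫ Π_{j=1}^M Π_{i=1}^{n_j} F_j(A_{i,j}) dπ(F_1,…,F_M), where π is the joint probability law of (F̃_1,…,F̃_M). -/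

import Mathlib

open MeasureTheory ProbabilityTheory Filter Topology
open scoped ENNReal NNReal

/-- A family of sequences `[X_{n,j}]` (columns indexed by `J`) is partially exchangeable in the
sense of de Finetti if its joint law is invariant under separate finite permutations within each
column. -/
def PartiallyExchangeable {Ω 𝕏 J : Type*} [MeasurableSpace Ω] [MeasurableSpace 𝕏]
    (μ : Measure Ω) (X : ℕ → J → Ω → 𝕏) : Prop :=
  ∀ σ : J → Equiv.Perm ℕ, (∀ j, {n | σ j n ≠ n}.Finite) →
    Measure.map (fun ω (p : ℕ × J) => X (σ p.2 p.1) p.2 ω) μ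
      = Measure.map (fun ω (p : ℕ × J) => X p.1 p.2 ω) μ

/-- The empirical distribution `F̂_n = (1/n) ∑_{i=1}^n δ_{X_i}`. -/
noncomputable def empMeas {Ω 𝕏 : Type*} [MeasurableSpace Ω] [MeasurableSpace 𝕏]
    (X : ℕ → Ω → 𝕏) (n : ℕ) (ω : Ω) : Measure 𝕏 :=
  (n : ℝ≥0∞)⁻¹ • ∑ i ∈ Finset.range n, Measure.dirac (X i ω)

/-- Weak convergence of a sequence of measures, phrased via integrals of bounded continuous
functions. -/
def TendstoWeakly {𝕏 : Type*} [MeasurableSpace 𝕏] [TopologicalSpace 𝕏]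
    (ν : ℕ → Measure 𝕏) (ρ : Measure 𝕏) : Prop :=
  ∀ f : BoundedContinuousFunction 𝕏 ℝ,
    Tendsto (fun n => ∫ x, f x ∂(ν n)) atTop (𝓝 (∫ x, f x ∂ρ))

/-- A sequence indexed below `n` by an injective map extends to a finitely supported permutation. -/
theorem exists_finite_perm_extending (n : ℕ) (e : ℕ → ℕ) (he : Set.InjOn e (Set.Iio n)) :
    ∃ σ : Equiv.Perm ℕ, {k | σ k ≠ k}.Finite ∧ ∀ i < n, σ i = e i := by
  induction n with
  | zero => exact ⟨1, by simp, by simp⟩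
  | succ n ih =>
    obtain ⟨σ, hfin, hσ⟩ := ih (he.mono fun i hi => Nat.lt_succ_of_lt hi)
    refine ⟨Equiv.swap (σ n) (e n) * σ, ?_, ?_⟩
    · refine (hfin.union (Set.toFinite {n, σ.symm (e n)})).subset fun k hk => ?_
      by_contra hcon
      simp only [Set.mem_union, Set.mem_ofPred_eq, Set.mem_insert_iff, Set.mem_singleton_iff,
        not_or, not_not] at hcon
      refine hk ?_
      rw [Equiv.Perm.mul_apply, Equiv.swap_apply_of_ne_of_ne, hcon.1]
      · exact fun h => hcon.2.1 (σ.injective h)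
      · exact fun h => hcon.2.2 (by rw [← h, Equiv.symm_apply_apply])
    · intro i hi
      rcases Nat.lt_succ_iff_lt_or_eq.1 hi with h | rfl
      · rw [Equiv.Perm.mul_apply, Equiv.swap_apply_of_ne_of_ne, hσ i h]
        · exact fun h' => h.ne (σ.injective h')
        · rw [hσ i h]
          exact fun h' => h.ne (he (Set.mem_Iio.2 hi) (Set.mem_Iio.2 n.lt_succ_self) h')
      · simp

/-- The averages of a bounded sequence with constant second moments and constant mixed moments are
Cauchy in `L²`, with an explicit rate. -/
theorem integral_sq_average_sub_le {α : Type*} [MeasurableSpace α] {ν : Measure α}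
    [IsProbabilityMeasure ν] {g : ℕ → α → ℝ} (hgm : ∀ i, Measurable (g i))
    (hg0 : ∀ i x, 0 ≤ g i x) (hg1 : ∀ i x, g i x ≤ 1) {c d : ℝ}
    (hd : ∀ i, ∫ x, g i x * g i x ∂ν = d) (hc : ∀ i k, i ≠ k → ∫ x, g i x * g k x ∂ν = c)
    {n m : ℕ} (hn : 0 < n) (hnm : n ≤ m) :
    ∫ x, ((∑ i ∈ Finset.range n, g i x) / n - (∑ i ∈ Finset.range m, g i x) / m) ^ 2 ∂ν
      ≤ 2 / n := by
  have hm : 0 < m := hn.trans_le hnm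
  have hn' : (0 : ℝ) < n := by exact_mod_cast hn
  have hm' : (0 : ℝ) < m := by exact_mod_cast hm
  have hnm' : (n : ℝ) ≤ m := by exact_mod_cast hnm
  have hgint : ∀ i k, Integrable (fun x => g i x * g k x) ν := fun i k =>
    Integrable.of_bound ((hgm i).mul (hgm k)).aestronglyMeasurable 1 (ae_of_all _ fun x => by
      rw [Real.norm_of_nonneg (mul_nonneg (hg0 i x) (hg0 k x))]
      exact mul_le_one₀ (hg1 i x) (hg0 k x) (hg1 k x))
  have hdc : d - c ≤ 1 := by
    have h1 : d ≤ 1 := by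
      rw [← hd 0]
      calc ∫ x, g 0 x * g 0 x ∂ν ≤ ∫ _, (1 : ℝ) ∂ν :=
            integral_mono (hgint 0 0) (integrable_const _) fun x =>
              mul_le_one₀ (hg1 0 x) (hg0 0 x) (hg1 0 x)
        _ = 1 := by simp
    have h2 : 0 ≤ c := by
      rw [← hc 0 1 (by simp)]
      exact integral_nonneg fun x => mul_nonneg (hg0 0 x) (hg0 1 x)
    linarith
  set w : ℕ → ℝ := fun i => (if i < n then (1 : ℝ) / n else 0) - 1 / m with hw
  have hfilter : (Finset.range m).filter (· < n) = Finset.range n := by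
    ext i; simp only [Finset.mem_filter, Finset.mem_range]; omega
  have hsum : ∀ x, (∑ i ∈ Finset.range n, g i x) / n - (∑ i ∈ Finset.range m, g i x) / m
      = ∑ i ∈ Finset.range m, w i * g i x := by
    intro x
    simp only [hw, sub_mul, ite_mul, zero_mul, Finset.sum_sub_distrib]
    rw [← Finset.sum_filter, hfilter, ← Finset.mul_sum, ← Finset.mul_sum]
    ring
  have hw0 : ∑ i ∈ Finset.range m, w i = 0 := by
    simp only [hw, Finset.sum_sub_distrib]
    rw [← Finset.sum_filter, hfilter]
    simp [hn'.ne', hm'.ne']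
  have hw2 : ∑ i ∈ Finset.range m, w i * w i ≤ 2 / n := by
    calc ∑ i ∈ Finset.range m, w i * w i
        ≤ ∑ i ∈ Finset.range m,
            ((if i < n then (1 : ℝ) / (n * n) else 0) + 1 / (m * m)) := by
          refine Finset.sum_le_sum fun i _ => ?_
          simp only [hw]
          have hp : 0 < (1 : ℝ) / n * (1 / m) := by positivity
          split_ifs
          · have e1 : (1 : ℝ) / (n * n) = 1 / n * (1 / n) := by field_simp
            have e2 : (1 : ℝ) / (m * m) = 1 / m * (1 / m) := by field_simp
            rw [e1, e2]; nlinarith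
          · have e2 : (1 : ℝ) / (m * m) = 1 / m * (1 / m) := by field_simp
            rw [e2]; nlinarith
      _ = 1 / n + 1 / m := by
          rw [Finset.sum_add_distrib, ← Finset.sum_filter, hfilter]
          simp only [Finset.sum_const, Finset.card_range, nsmul_eq_mul]
          field_simp
      _ ≤ 2 / n := by
          have := one_div_le_one_div_of_le hn' hnm'
          have e : (2 : ℝ) / n = 1 / n + 1 / n := by ring
          linarith
  have hw2' : 0 ≤ ∑ i ∈ Finset.range m, w i * w i :=
    Finset.sum_nonneg fun i _ => mul_self_nonneg _
  have hmom : ∀ i k, ∫ x, g i x * g k x ∂ν = c + if i = k then d - c else 0 := by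
    intro i k
    split_ifs with h
    · subst h; rw [hd]; ring
    · rw [hc i k h, add_zero]
  calc ∫ x, ((∑ i ∈ Finset.range n, g i x) / n - (∑ i ∈ Finset.range m, g i x) / m) ^ 2 ∂ν
      = ∫ x, ∑ i ∈ Finset.range m, ∑ k ∈ Finset.range m, w i * w k * (g i x * g k x) ∂ν := by
        congr 1; ext x
        rw [hsum, sq, Finset.sum_mul_sum]
        exact Finset.sum_congr rfl fun i _ => Finset.sum_congr rfl fun k _ => by ring
    _ = ∑ i ∈ Finset.range m, ∑ k ∈ Finset.range m,
          w i * w k * (c + if i = k then d - c else 0) := by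
        rw [integral_finsetSum _ fun i _ => integrable_finsetSum _ fun k _ =>
          (hgint i k).const_mul _]
        refine Finset.sum_congr rfl fun i _ => ?_
        rw [integral_finsetSum _ fun k _ => (hgint i k).const_mul _]
        refine Finset.sum_congr rfl fun k _ => ?_
        rw [integral_const_mul, hmom]
    _ = (∑ i ∈ Finset.range m, w i) * (∑ i ∈ Finset.range m, w i) * c
          + (d - c) * ∑ i ∈ Finset.range m, w i * w i := by
        simp only [mul_add, Finset.sum_add_distrib, mul_ite, mul_zero]
        congr 1
        · rw [Finset.sum_mul_sum, Finset.sum_mul]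
          exact Finset.sum_congr rfl fun i _ => by rw [Finset.sum_mul]
        · rw [Finset.mul_sum]
          refine Finset.sum_congr rfl fun i hi => ?_
          rw [Finset.sum_ite_eq, if_pos hi]; ring
    _ ≤ 2 / n := by
        rw [hw0]
        nlinarith

/-- Almost sure convergence of the averages of a bounded nonnegative sequence with constant second
moments and constant mixed moments. -/
theorem ae_exists_tendsto_average {α : Type*} [MeasurableSpace α] {ν : Measure α}
    [IsProbabilityMeasure ν] {g : ℕ → α → ℝ} (hgm : ∀ i, Measurable (g i))
    (hg0 : ∀ i x, 0 ≤ g i x) (hg1 : ∀ i x, g i x ≤ 1) {c d : ℝ}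
    (hd : ∀ i, ∫ x, g i x * g i x ∂ν = d) (hc : ∀ i k, i ≠ k → ∫ x, g i x * g k x ∂ν = c) :
    ∀ᵐ x ∂ν, ∃ l, Tendsto (fun n : ℕ => (∑ i ∈ Finset.range n, g i x) / n) atTop (𝓝 l) := by
  set a : ℕ → α → ℝ := fun n x => (∑ i ∈ Finset.range n, g i x) / n with ha
  have ham : ∀ n, Measurable (a n) := fun n =>
    (Finset.measurable_fun_sum _ fun i _ => hgm i).div_const _
  have ha0 : ∀ n x, 0 ≤ a n x := fun n x =>
    div_nonneg (Finset.sum_nonneg fun i _ => hg0 i x) n.cast_nonneg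
  have ha1 : ∀ n x, a n x ≤ 1 := fun n x => by
    refine div_le_one_of_le₀ ?_ n.cast_nonneg
    calc ∑ i ∈ Finset.range n, g i x ≤ ∑ _i ∈ Finset.range n, (1 : ℝ) :=
          Finset.sum_le_sum fun i _ => hg1 i x
      _ = n := by simp
  have hab : ∀ n m x, |a n x - a m x| ≤ 1 := fun n m x => by
    rw [abs_le]; constructor <;> linarith [ha0 n x, ha0 m x, ha1 n x, ha1 m x]
  set D : ℕ → α → ℝ := fun k x => |a ((k + 1) ^ 4) x - a ((k + 2) ^ 4) x| with hD
  have hDm : ∀ k, Measurable (D k) := fun k => ((ham _).sub (ham _)).abs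
  have hDint : ∀ k, Integrable (D k) ν := fun k =>
    Integrable.of_bound (hDm k).aestronglyMeasurable 1 (ae_of_all _ fun x => by
      simpa [hD] using hab _ _ x)
  have hbound : ∀ k, ∫ x, D k x ∂ν ≤ 3 * (1 / ((k : ℝ) + 1) ^ 2) := by
    intro k
    have hk : (0 : ℝ) < (k : ℝ) + 1 := by positivity
    have hsq := integral_sq_average_sub_le hgm hg0 hg1 hd hc (n := (k + 1) ^ 4)
      (m := (k + 2) ^ 4) (by positivity) (Nat.pow_le_pow_left (by omega) 4)
    have hsqint : Integrable (fun x => (a ((k + 1) ^ 4) x - a ((k + 2) ^ 4) x) ^ 2) ν :=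
      Integrable.of_bound (((ham _).sub (ham _)).pow_const 2).aestronglyMeasurable 1
        (ae_of_all _ fun x => by
          rw [norm_pow, Real.norm_eq_abs]
          exact pow_le_one₀ (abs_nonneg _) (hab _ _ x))
    calc ∫ x, D k x ∂ν
        ≤ ∫ x, (1 / ((k : ℝ) + 1) ^ 2
            + ((k : ℝ) + 1) ^ 2 * (a ((k + 1) ^ 4) x - a ((k + 2) ^ 4) x) ^ 2) ∂ν := by
          refine integral_mono (hDint k) ((integrable_const _).add (hsqint.const_mul _))
            fun x => ?_
          simp only [hD]
          set t := a ((k + 1) ^ 4) x - a ((k + 2) ^ 4) x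
          rw [← sq_abs t]
          have h1 : (1 / ((k : ℝ) + 1)) * (((k : ℝ) + 1)) = 1 := by field_simp
          have h2 : 1 / ((k : ℝ) + 1) ^ 2 = (1 / ((k : ℝ) + 1)) ^ 2 := by field_simp
          rw [h2]
          nlinarith [sq_nonneg (1 / ((k : ℝ) + 1) - ((k : ℝ) + 1) * |t|), abs_nonneg t]
      _ = 1 / ((k : ℝ) + 1) ^ 2
            + ((k : ℝ) + 1) ^ 2 * ∫ x, (a ((k + 1) ^ 4) x - a ((k + 2) ^ 4) x) ^ 2 ∂ν := by
          rw [integral_add (integrable_const _) (hsqint.const_mul _), integral_const_mul]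
          simp
      _ ≤ 1 / ((k : ℝ) + 1) ^ 2 + ((k : ℝ) + 1) ^ 2 * (2 / (((k + 1) ^ 4 : ℕ) : ℝ)) := by
          gcongr
      _ = 3 * (1 / ((k : ℝ) + 1) ^ 2) := by
          push_cast; field_simp; norm_num
  have hsummable : Summable fun k => ∫ x, D k x ∂ν := by
    refine Summable.of_nonneg_of_le (fun k => integral_nonneg fun x => abs_nonneg _) hbound
      (Summable.mul_left _ ?_)
    simpa using (summable_nat_add_iff 1).2 (Real.summable_one_div_nat_pow.2 one_lt_two)
  have hae : ∀ᵐ x ∂ν, Summable fun k => D k x := by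
    have hfin : ∫⁻ x, ∑' k, ENNReal.ofReal (D k x) ∂ν ≠ ∞ := by
      rw [lintegral_tsum fun k => (hDm k).ennreal_ofReal.aemeasurable]
      simp_rw [← ofReal_integral_eq_lintegral_ofReal (hDint _)
        (ae_of_all _ fun x => abs_nonneg _)]
      exact hsummable.tsum_ofReal_ne_top
    filter_upwards [ae_lt_top (Measurable.tsum fun k => (hDm k).ennreal_ofReal) hfin]
      with x hx
    have := ENNReal.summable_toReal hx.ne
    simpa [ENNReal.toReal_ofReal, hD] using this
  filter_upwards [hae] with x hx
  have hcau : CauchySeq fun k => a ((k + 1) ^ 4) x :=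
    cauchySeq_of_summable_dist (by simpa [Real.dist_eq, hD, add_assoc] using hx)
  obtain ⟨l, hl⟩ := cauchySeq_tendsto_of_complete hcau
  refine ⟨l, tendsto_div_of_monotone_of_exists_subseq_tendsto_div _ l ?_ fun b hb => ?_⟩
  · exact fun n m hnm => Finset.sum_le_sum_of_subset_of_nonneg
      (Finset.range_subset_range.2 hnm) fun i _ _ => hg0 i x
  · refine ⟨fun k => (k + 1) ^ 4, ?_, ?_, hl⟩
    · have hlim : Tendsto (fun k : ℕ => (1 + 1 / ((k : ℝ) + 1)) ^ 4) atTop (𝓝 ((1 + 0) ^ 4)) :=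
        (tendsto_const_nhds.add tendsto_one_div_add_atTop_nhds_zero_nat).pow 4
      filter_upwards [hlim.eventually_le_const (show ((1 : ℝ) + 0) ^ 4 < b by simpa using hb)]
        with k hk
      have hk0 : (0 : ℝ) < (k : ℝ) + 1 := by positivity
      calc (((k + 1 + 1) ^ 4 : ℕ) : ℝ) = (1 + 1 / ((k : ℝ) + 1)) ^ 4 * ((k : ℝ) + 1) ^ 4 := by
            push_cast; rw [← mul_pow]; congr 1; field_simp
        _ ≤ b * (((k + 1) ^ 4 : ℕ) : ℝ) := by
            push_cast; gcongr
    · exact (tendsto_pow_atTop (by norm_num)).comp (tendsto_add_atTop_nat 1)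

/-- The law of a sequence is exchangeable if it is invariant under finite permutations. -/
def ExchangeableLaw {𝕏 : Type*} [MeasurableSpace 𝕏] (ν : Measure (ℕ → 𝕏)) : Prop :=
  ∀ σ : Equiv.Perm ℕ, {n | σ n ≠ n}.Finite → ν.map (fun x i => x (σ i)) = ν

/-- The σ-algebra of events on sequences invariant under all finite permutations. -/
@[reducible]
def exchangeableSigmaAlgebra (𝕏 : Type*) [MeasurableSpace 𝕏] : MeasurableSpace (ℕ → 𝕏) :=
  ⨅ σ : {σ : Equiv.Perm ℕ // {n | σ n ≠ n}.Finite},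
    MeasurableSpace.invariants fun (x : ℕ → 𝕏) i => x (σ.1 i)

theorem exchangeableSigmaAlgebra_le (𝕏 : Type*) [MeasurableSpace 𝕏] :
    exchangeableSigmaAlgebra 𝕏 ≤ MeasurableSpace.pi :=
  (iInf_le _ ⟨1, by simp⟩).trans (MeasurableSpace.invariants_le _)

theorem finite_swap_support (i k : ℕ) : {n | Equiv.swap i k n ≠ n}.Finite := by
  refine (Set.toFinite {i, k}).subset fun n hn => ?_
  by_contra h
  simp only [Set.mem_insert_iff, Set.mem_singleton_iff, not_or] at h
  exact hn (Equiv.swap_apply_of_ne_of_ne h.1 h.2)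

/-- A finite permutation does not change the sums of long enough initial segments. -/
theorem eventually_sum_range_perm (σ : Equiv.Perm ℕ) (hσ : {n | σ n ≠ n}.Finite) (f : ℕ → ℝ) :
    ∀ᶠ n in atTop, ∑ i ∈ Finset.range n, f (σ i) = ∑ i ∈ Finset.range n, f i := by
  obtain ⟨N, hN⟩ := hσ.bddAbove
  filter_upwards [eventually_gt_atTop N] with n hn
  refine Equiv.Perm.sum_comp σ _ f fun i hi => ?_
  exact Finset.mem_coe.2 (Finset.mem_range.2 ((hN hi).trans_lt hn))

theorem measurable_limsup_average {𝕏 : Type*} [MeasurableSpace 𝕏] {f : 𝕏 → ℝ}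
    (hf : Measurable f) :
    Measurable[exchangeableSigmaAlgebra 𝕏] fun x : ℕ → 𝕏 =>
      limsup (fun n : ℕ => (∑ i ∈ Finset.range n, f (x i)) / n) atTop := by
  intro s hs
  rw [MeasurableSpace.measurableSet_iInf]
  rintro ⟨σ, hσ⟩
  rw [MeasurableSpace.measurableSet_invariants]
  constructor
  · refine Measurable.limsup (fun n => ?_) hs
    exact (Finset.measurable_fun_sum _ fun i _ => hf.comp (measurable_pi_apply i)).div_const _
  · ext x
    simp only [Set.mem_preimage]
    rw [limsup_congr ((eventually_sum_range_perm σ hσ fun i => f (x i)).mono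
      fun n hn => by rw [hn])]

/-- The law of large numbers for exchangeable sequences: there is a random probability measure
which gives the limit of the empirical frequencies of every measurable set. -/
theorem ExchangeableLaw.exists_directing_measure {𝕏 : Type*} [MeasurableSpace 𝕏]
    [StandardBorelSpace 𝕏] {ν : Measure (ℕ → 𝕏)} [IsProbabilityMeasure ν]
    (hν : ExchangeableLaw ν) :
    ∃ F : (ℕ → 𝕏) → Measure 𝕏, Measurable F ∧ (∀ x, IsProbabilityMeasure (F x)) ∧
      ∀ A, MeasurableSet A → ∀ᵐ x ∂ν,
        Tendsto (fun n : ℕ => (∑ i ∈ Finset.range n, A.indicator (fun _ => (1 : ℝ)) (x i)) / n)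
          atTop (𝓝 ((F x).real A)) := by
  have hle := exchangeableSigmaAlgebra_le 𝕏
  refine ⟨fun x => (condExpKernel ν (exchangeableSigmaAlgebra 𝕏) x).map (fun y => y 0),
    ?_, ?_, ?_⟩
  · exact (Measure.measurable_map _ (measurable_pi_apply 0)).comp
      ((condExpKernel ν (exchangeableSigmaAlgebra 𝕏)).measurable.mono
        hle le_rfl)
  · exact fun x => Measure.isProbabilityMeasure_map (measurable_pi_apply 0).aemeasurable
  intro A hA
  set f : 𝕏 → ℝ := A.indicator fun _ => (1 : ℝ)
  have hfm : Measurable f := measurable_const.indicator hA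
  have hf0 : ∀ y, 0 ≤ f y := fun y => Set.indicator_nonneg (fun _ _ => zero_le_one) y
  have hf1 : ∀ y, f y ≤ 1 := fun y => Set.indicator_le_self' (fun _ _ => zero_le_one) y
  have hperm : ∀ σ : Equiv.Perm ℕ, {n | σ n ≠ n}.Finite → ∀ h : (ℕ → 𝕏) → ℝ, Measurable h →
      ∫ x, h (fun i => x (σ i)) ∂ν = ∫ x, h x ∂ν := by
    intro σ hσ h hh
    conv_rhs => rw [← hν σ hσ]
    rw [integral_map (measurable_pi_lambda _ fun i => measurable_pi_apply (σ i)).aemeasurable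
      hh.aestronglyMeasurable]
  have hgm : ∀ i, Measurable fun x : ℕ → 𝕏 => f (x i) := fun i =>
    hfm.comp (measurable_pi_apply i)
  have hconv := ae_exists_tendsto_average (ν := ν) (g := fun i x => f (x i)) hgm
    (fun i x => hf0 _) (fun i x => hf1 _)
    (d := ∫ x, f (x 0) * f (x 0) ∂ν) (c := ∫ x, f (x 0) * f (x 1) ∂ν)
    (fun i => by
      have := hperm (Equiv.swap 0 i) (finite_swap_support 0 i) (fun x => f (x 0) * f (x 0))
        ((hgm 0).mul (hgm 0))
      simpa using this)
    (fun i k hik => by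
      obtain ⟨σ, hσ, hσ'⟩ := exists_finite_perm_extending 2 (fun n => if n = 0 then i else k)
        (by
          intro a ha b hb hab
          simp only [Set.mem_Iio] at ha hb
          interval_cases a <;> interval_cases b <;> simp_all)
      have := hperm σ hσ (fun x => f (x 0) * f (x 1)) ((hgm 0).mul (hgm 1))
      simpa [hσ' 0 (by norm_num), hσ' 1 (by norm_num)] using this)
  set L : (ℕ → 𝕏) → ℝ := fun x =>
    limsup (fun n : ℕ => (∑ i ∈ Finset.range n, f (x i)) / n) atTop with hL
  have hLm : Measurable[exchangeableSigmaAlgebra 𝕏] L := measurable_limsup_average hfm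
  have hconvL : ∀ᵐ x ∂ν, Tendsto (fun n : ℕ => (∑ i ∈ Finset.range n, f (x i)) / n) atTop
      (𝓝 (L x)) := by
    filter_upwards [hconv] with x ⟨l, hl⟩
    simpa only [hL, hl.limsup_eq] using hl
  have hav : ∀ (n : ℕ) (x : ℕ → 𝕏), ‖(∑ i ∈ Finset.range n, f (x i)) / n‖ ≤ 1 := by
    intro n x
    rw [Real.norm_of_nonneg (div_nonneg (Finset.sum_nonneg fun i _ => hf0 _) n.cast_nonneg)]
    refine div_le_one_of_le₀ ?_ n.cast_nonneg
    calc ∑ i ∈ Finset.range n, f (x i) ≤ ∑ _i ∈ Finset.range n, (1 : ℝ) :=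
          Finset.sum_le_sum fun i _ => hf1 _
      _ = n := by simp
  have hLint : Integrable L ν :=
    Integrable.of_bound (hLm.mono hle le_rfl).aestronglyMeasurable 1 (by
      filter_upwards [hconvL] with x hx
      exact le_of_tendsto hx.norm (Eventually.of_forall fun n => hav n x))
  have hfint : ∀ i, Integrable (fun x : ℕ → 𝕏 => f (x i)) ν := fun i =>
    Integrable.of_bound (hgm i).aestronglyMeasurable 1 (ae_of_all _ fun x => by
      rw [Real.norm_of_nonneg (hf0 _)]; exact hf1 _)
  have hcond : L =ᵐ[ν] ν[fun x => f (x 0) | exchangeableSigmaAlgebra 𝕏] := by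
    refine ae_eq_condExp_of_forall_setIntegral_eq hle (hfint 0)
      (fun s _ _ => hLint.integrableOn) (fun s hs _ => ?_) hLm.aestronglyMeasurable
    have hs' : MeasurableSet s := hle s hs
    have hswap : ∀ i, ∫ x in s, f (x i) ∂ν = ∫ x in s, f (x 0) ∂ν := by
      intro i
      have hinv := (MeasurableSpace.measurableSet_invariants.1
        (MeasurableSpace.measurableSet_iInf.1 hs
          ⟨Equiv.swap 0 i, finite_swap_support 0 i⟩)).2
      have := hperm (Equiv.swap 0 i) (finite_swap_support 0 i)
        (s.indicator fun x => f (x 0)) ((hgm 0).indicator hs')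
      rw [integral_indicator hs'] at this
      rw [← this, ← integral_indicator hs']
      congr 1; ext x
      have hmem : (fun k => x (Equiv.swap 0 i k)) ∈ s ↔ x ∈ s := by
        conv_rhs => rw [← hinv]
        rfl
      by_cases hx : x ∈ s
      · rw [Set.indicator_of_mem hx, Set.indicator_of_mem (hmem.2 hx)]
        simp
      · rw [Set.indicator_of_notMem hx, Set.indicator_of_notMem (mt hmem.1 hx)]
    have hlim : Tendsto (fun n : ℕ => ∫ x in s, (∑ i ∈ Finset.range n, f (x i)) / n ∂ν) atTop
        (𝓝 (∫ x in s, L x ∂ν)) :=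
      tendsto_integral_filter_of_norm_le_const
        (Eventually.of_forall fun n => ((Finset.measurable_fun_sum _ fun i _ =>
          hgm i).div_const _).aestronglyMeasurable)
        ⟨1, Eventually.of_forall fun n => ae_of_all _ fun x => hav n x⟩
        (ae_restrict_of_ae hconvL)
    refine tendsto_nhds_unique hlim (tendsto_const_nhds.congr' ?_)
    filter_upwards [eventually_gt_atTop 0] with n hn
    have hn' : (n : ℝ) ≠ 0 := by exact_mod_cast hn.ne'
    rw [integral_div, integral_finsetSum _ fun i _ => (hfint i).integrableOn]
    simp [hswap, hn']
  have hker := condExpKernel_ae_eq_condExp (μ := ν) hle (measurable_pi_apply 0 hA)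
  have hind : ((fun y : ℕ → 𝕏 => y 0) ⁻¹' A).indicator (fun _ => (1 : ℝ))
      = fun x => f (x 0) := rfl
  rw [hind] at hker
  filter_upwards [hconvL, hcond, hker] with x h1 h2 h3
  rw [map_measureReal_apply (measurable_pi_apply 0) hA, h3, ← h2]
  exact h1

theorem empMeas_real_apply {Ω 𝕏 : Type*} [MeasurableSpace Ω] [MeasurableSpace 𝕏]
    (X : ℕ → Ω → 𝕏) (n : ℕ) (ω : Ω) {s : Set 𝕏} (hs : MeasurableSet s) :
    (empMeas X n ω).real s
      = (∑ i ∈ Finset.range n, s.indicator (fun _ => (1 : ℝ)) (X i ω)) / n := by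
  rw [empMeas, measureReal_def, Measure.smul_apply, Measure.finsetSum_apply, smul_eq_mul,
    ENNReal.toReal_mul, ENNReal.toReal_inv, ENNReal.toReal_natCast, ENNReal.toReal_sum (by simp),
    div_eq_inv_mul]
  congr 1
  refine Finset.sum_congr rfl fun i _ => ?_
  rw [Measure.dirac_apply' _ hs]
  by_cases h : X i ω ∈ s <;> simp [h]

theorem isProbabilityMeasure_empMeas {Ω 𝕏 : Type*} [MeasurableSpace Ω] [MeasurableSpace 𝕏]
    (X : ℕ → Ω → 𝕏) (n : ℕ) (ω : Ω) : IsProbabilityMeasure (empMeas X (n + 1) ω) := by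
  constructor
  rw [empMeas, Measure.smul_apply, Measure.finsetSum_apply]
  simp only [measure_univ, Finset.sum_const, Finset.card_range, smul_eq_mul, nsmul_eq_mul, mul_one]
  exact ENNReal.inv_mul_cancel (by simp) (by simp)

/-- Convergence of frequencies along a suitable π-system implies weak convergence of the empirical
measures. -/
theorem tendstoWeakly_empMeas {Ω 𝕏 : Type*} [MeasurableSpace Ω] [MeasurableSpace 𝕏]
    [TopologicalSpace 𝕏] [SecondCountableTopology 𝕏] [OpensMeasurableSpace 𝕏]
    [HasOuterApproxClosed 𝕏]
    {S : Set (Set 𝕏)} (hS : IsPiSystem S) (hmeas : ∀ s ∈ S, MeasurableSet s)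
    (hnhds : ∀ u : Set 𝕏, IsOpen u → ∀ x ∈ u, ∃ s ∈ S, s ∈ 𝓝 x ∧ s ⊆ u)
    (X : ℕ → Ω → 𝕏) (ω : Ω) (ρ : Measure 𝕏) [IsProbabilityMeasure ρ]
    (h : ∀ s ∈ S, Tendsto
      (fun n : ℕ => (∑ i ∈ Finset.range n, s.indicator (fun _ => (1 : ℝ)) (X i ω)) / n) atTop
      (𝓝 (ρ.real s))) :
    TendstoWeakly (fun n => empMeas X n ω) ρ := by
  intro f
  rw [← tendsto_add_atTop_iff_nat 1]
  let P : ℕ → ProbabilityMeasure 𝕏 := fun n =>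
    ⟨empMeas X (n + 1) ω, isProbabilityMeasure_empMeas X n ω⟩
  let R : ProbabilityMeasure 𝕏 := ⟨ρ, inferInstance⟩
  have hlim : Tendsto P atTop (𝓝 R) := by
    refine hS.tendsto_probabilityMeasure_of_tendsto_of_mem hmeas hnhds fun s hs => ?_
    rw [← NNReal.tendsto_coe]
    refine ((tendsto_add_atTop_iff_nat 1).2 (h s hs)).congr fun n => ?_
    rw [← empMeas_real_apply X (n + 1) ω (hmeas s hs)]
    rfl
  exact ProbabilityMeasure.tendsto_iff_forall_integral_tendsto.1 hlim f

/-- A second countable space has a countable π-system of open sets forming a basis. -/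
theorem exists_countable_isPiSystem_basis (𝕏 : Type*) [TopologicalSpace 𝕏]
    [SecondCountableTopology 𝕏] :
    ∃ S : Set (Set 𝕏), S.Countable ∧ IsPiSystem S ∧ (∀ s ∈ S, IsOpen s) ∧
      ∀ u : Set 𝕏, IsOpen u → ∀ x ∈ u, ∃ s ∈ S, s ∈ 𝓝 x ∧ s ⊆ u := by
  have hB := TopologicalSpace.isBasis_countableBasis 𝕏
  refine ⟨Set.sInter '' {t | t.Finite ∧ t ⊆ TopologicalSpace.countableBasis 𝕏},
    (Set.countable_ofPred_finite_subset (TopologicalSpace.countable_countableBasis 𝕏)).image _,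
    ?_, ?_, ?_⟩
  · rintro _ ⟨t, ht, rfl⟩ _ ⟨t', ht', rfl⟩ -
    exact ⟨t ∪ t', ⟨ht.1.union ht'.1, Set.union_subset ht.2 ht'.2⟩, Set.sInter_union t t'⟩
  · rintro _ ⟨t, ht, rfl⟩
    exact ht.1.isOpen_sInter fun s hs => hB.isOpen (ht.2 hs)
  · intro u hu x hx
    obtain ⟨s, hs, hxs, hsu⟩ := hB.exists_subset_of_mem_open hx hu
    exact ⟨s, ⟨{s}, ⟨Set.finite_singleton s, Set.singleton_subset_iff.2 hs⟩,
      Set.sInter_singleton s⟩, (hB.isOpen hs).mem_nhds hxs, hsu⟩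

/-- If averages converge along the whole sequence, so do the averages over the consecutive blocks
`[qN, (q+1)N)`. -/
theorem tendsto_block_average {u : ℕ → ℝ} {l : ℝ}
    (h : Tendsto (fun n : ℕ => (∑ i ∈ Finset.range n, u i) / n) atTop (𝓝 l)) (q : ℕ) :
    Tendsto (fun N : ℕ => (∑ i ∈ Finset.Ico (q * N) ((q + 1) * N), u i) / N) atTop (𝓝 l) := by
  have hsub : ∀ r : ℕ, Tendsto (fun N : ℕ => (∑ i ∈ Finset.range (r * N), u i) / N) atTop
      (𝓝 (r * l)) := by
    intro r
    rcases Nat.eq_zero_or_pos r with rfl | hr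
    · simp
    · have hr' : (r : ℝ) ≠ 0 := by exact_mod_cast hr.ne'
      refine ((h.comp (tendsto_id.const_mul_atTop' hr)).const_mul (r : ℝ)).congr fun N => ?_
      simp only [Function.comp_apply, id, Nat.cast_mul]
      rw [mul_div_assoc', mul_div_mul_left _ _ hr']
  have := (hsub (q + 1)).sub (hsub q)
  rw [show ((q + 1 : ℕ) : ℝ) * l - q * l = l by push_cast; ring] at this
  refine this.congr fun N => ?_
  rw [Finset.sum_Ico_eq_sub _ (Nat.mul_le_mul_right N q.le_succ), sub_div]

/-- If the mixed moments of finitely many bounded sequences do not depend on the choice of the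
indices in disjoint blocks, they equal the moment of the limits of the averages. -/
theorem integral_prod_limit_average {α ι : Type*} [MeasurableSpace α] [Fintype ι]
    {ν : Measure α} [IsProbabilityMeasure ν] {G : ι → ℕ → α → ℝ}
    (hGm : ∀ p k, Measurable (G p k)) (hG0 : ∀ p k x, 0 ≤ G p k x) (hG1 : ∀ p k x, G p k x ≤ 1)
    (q : ι → ℕ) {C : ℝ}
    (hC : ∀ (N : ℕ) (κ : ι → ℕ), (∀ p, κ p ∈ Finset.Ico (q p * N) ((q p + 1) * N)) →
      ∫ x, ∏ p, G p (κ p) x ∂ν = C)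
    {L : ι → α → ℝ}
    (hL : ∀ p, ∀ᵐ x ∂ν,
      Tendsto (fun n : ℕ => (∑ k ∈ Finset.range n, G p k x) / n) atTop (𝓝 (L p x))) :
    ∫ x, ∏ p, L p x ∂ν = C := by
  classical
  have hblock : ∀ (N : ℕ) (p : ι) (x : α),
      0 ≤ (∑ k ∈ Finset.Ico (q p * N) ((q p + 1) * N), G p k x) / N ∧
      (∑ k ∈ Finset.Ico (q p * N) ((q p + 1) * N), G p k x) / N ≤ 1 := by
    intro N p x
    refine ⟨div_nonneg (Finset.sum_nonneg fun k _ => hG0 p k x) N.cast_nonneg,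
      div_le_one_of_le₀ ?_ N.cast_nonneg⟩
    calc ∑ k ∈ Finset.Ico (q p * N) ((q p + 1) * N), G p k x
        ≤ ∑ _k ∈ Finset.Ico (q p * N) ((q p + 1) * N), (1 : ℝ) :=
          Finset.sum_le_sum fun k _ => hG1 p k x
      _ = N := by simp [add_mul]
  have hlim : Tendsto (fun N : ℕ =>
      ∫ x, ∏ p, (∑ k ∈ Finset.Ico (q p * N) ((q p + 1) * N), G p k x) / N ∂ν) atTop
      (𝓝 (∫ x, ∏ p, L p x ∂ν)) := by
    refine tendsto_integral_filter_of_norm_le_const (Eventually.of_forall fun N => ?_)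
      ⟨1, Eventually.of_forall fun N => ae_of_all _ fun x => ?_⟩ ?_
    · exact (Finset.measurable_fun_prod _ fun p _ =>
        (Finset.measurable_fun_sum _ fun k _ => hGm p k).div_const _).aestronglyMeasurable
    · rw [Real.norm_of_nonneg (Finset.prod_nonneg fun p _ => (hblock N p x).1)]
      exact Finset.prod_le_one (fun p _ => (hblock N p x).1) fun p _ => (hblock N p x).2
    · filter_upwards [ae_all_iff.2 hL] with x hx
      exact tendsto_finsetProd _ fun p _ => tendsto_block_average (hx p) (q p)
  refine tendsto_nhds_unique hlim (tendsto_const_nhds.congr' ?_)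
  filter_upwards [eventually_gt_atTop 0] with N hN
  have hN' : (N : ℝ) ≠ 0 := by exact_mod_cast hN.ne'
  have hgint : ∀ κ : ι → ℕ, Integrable (fun x => ∏ p, G p (κ p) x) ν := fun κ =>
    Integrable.of_bound
      (Finset.measurable_fun_prod _ fun p _ => hGm p (κ p)).aestronglyMeasurable 1
      (ae_of_all _ fun x => by
        rw [Real.norm_of_nonneg (Finset.prod_nonneg fun p _ => hG0 p _ x)]
        exact Finset.prod_le_one (fun p _ => hG0 p _ x) fun p _ => hG1 p _ x)
  simp_rw [Finset.prod_div_distrib, Finset.prod_univ_sum]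
  rw [integral_div, integral_finsetSum _ fun κ _ => hgint κ,
    Finset.sum_congr rfl fun κ hκ => hC N κ (Fintype.mem_piFinset.1 hκ)]
  simp [Fintype.card_piFinset, add_mul, hN']

/-- The law of each column of a partially exchangeable family is exchangeable. -/
theorem PartiallyExchangeable.exchangeableLaw {Ω 𝕏 J : Type*} [MeasurableSpace Ω]
    [MeasurableSpace 𝕏] {μ : Measure Ω} {X : ℕ → J → Ω → 𝕏} (hX : ∀ n j, Measurable (X n j))
    (hpe : PartiallyExchangeable μ X) (j : J) :
    ExchangeableLaw (μ.map fun ω i => X i j ω) := by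
  intro σ hσ
  have hcol : Measurable fun (x : ℕ × J → 𝕏) (i : ℕ) => x (i, j) :=
    measurable_pi_lambda _ fun i => measurable_pi_apply _
  have h := congrArg (Measure.map fun (x : ℕ × J → 𝕏) (i : ℕ) => x (i, j))
    (hpe (fun _ => σ) fun _ => hσ)
  rw [Measure.map_map hcol (measurable_pi_lambda _ fun p => hX _ _),
    Measure.map_map hcol (measurable_pi_lambda _ fun p => hX _ _)] at h
  rw [Measure.map_map (measurable_pi_lambda _ fun i => measurable_pi_apply _)
    (measurable_pi_lambda _ fun i => hX i j)]
  exact h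

/-- **Law of large numbers and de Finetti representation theorem for partially exchangeable
families of sequences.** The marginal empirical distributions converge a.s. weakly to a vector
of random probability measures `(F̃_j)_{j}`; conditionally on it, the columns are independent
and the observations within column `j` are i.i.d. from `F̃_j`, i.e. the joint law of any finite
sub-family is the mixture of products directed by the joint law of `(F̃_j)_j`. -/
theorem statement8
    {Ω 𝕏 J : Type*} [MeasurableSpace Ω] [MeasurableSpace 𝕏] [TopologicalSpace 𝕏]
    [PolishSpace 𝕏] [BorelSpace 𝕏] [Countable J]
    (μ : Measure Ω) [IsProbabilityMeasure μ]
    (X : ℕ → J → Ω → 𝕏) (hX : ∀ n j, Measurable (X n j))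
    (hpe : PartiallyExchangeable μ X) :
    ∃ F : J → Ω → Measure 𝕏,
      (∀ j, Measurable (F j)) ∧
      (∀ j ω, IsProbabilityMeasure (F j ω)) ∧
      (∀ᵐ ω ∂μ, ∀ j, TendstoWeakly (fun n => empMeas (fun i => X i j) n ω) (F j ω)) ∧
      (∀ (S : Finset J) (nn : J → ℕ) (A : ℕ → J → Set 𝕏),
        (∀ i j, MeasurableSet (A i j)) →
        μ {ω | ∀ j ∈ S, ∀ i < nn j, X i j ω ∈ A i j}
          = ∫⁻ ω, ∏ j ∈ S, ∏ i ∈ Finset.range (nn j), F j ω (A i j) ∂μ) := by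
  classical
  have hcol : ∀ j, Measurable fun ω i => X i j ω := fun j =>
    measurable_pi_lambda _ fun i => hX i j
  have hprob : ∀ j, IsProbabilityMeasure (μ.map fun ω i => X i j ω) := fun j =>
    Measure.isProbabilityMeasure_map (hcol j).aemeasurable
  choose K hKm hKp hK using fun j =>
    (hpe.exchangeableLaw hX j).exists_directing_measure
  have hfreq : ∀ j A, MeasurableSet A → ∀ᵐ ω ∂μ,
      Tendsto (fun n : ℕ => (∑ i ∈ Finset.range n, A.indicator (fun _ => (1 : ℝ)) (X i j ω)) / n)
        atTop (𝓝 ((K j fun i => X i j ω).real A)) := fun j A hA =>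
    ae_of_ae_map (hcol j).aemeasurable (hK j A hA)
  refine ⟨fun j ω => K j fun i => X i j ω, fun j => (hKm j).comp (hcol j), fun j ω => hKp j _,
    ?_, fun S nn A hA => ?_⟩
  · obtain ⟨S, hSc, hSpi, hSo, hSn⟩ := exists_countable_isPiSystem_basis 𝕏
    refine ae_all_iff.2 fun j => ?_
    filter_upwards [(ae_ball_iff hSc).2 fun s hs => hfreq j s (hSo s hs).measurableSet] with ω hω
    have := hKp j fun i => X i j ω
    exact tendstoWeakly_empMeas hSpi (fun s hs => (hSo s hs).measurableSet) hSn _ ω _ hω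
  · let ι := (j : S) × Fin (nn j)
    let G : ι → ℕ → Ω → ℝ := fun p k ω =>
      (A p.2 p.1).indicator (fun _ => (1 : ℝ)) (X k p.1 ω)
    have hGm : ∀ p k, Measurable (G p k) := fun p k =>
      (measurable_const.indicator (hA p.2 p.1)).comp (hX k p.1)
    have hG0 : ∀ p k ω, 0 ≤ G p k ω := fun p k ω =>
      Set.indicator_nonneg (fun _ _ => zero_le_one) _
    have hG1 : ∀ p k ω, G p k ω ≤ 1 := fun p k ω =>
      Set.indicator_le_self' (fun _ _ => zero_le_one) _
    have hinv : ∀ (N : ℕ) (κ : ι → ℕ),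
        (∀ p, κ p ∈ Finset.Ico ((p.2 : ℕ) * N) (((p.2 : ℕ) + 1) * N)) →
        ∫ ω, ∏ p, G p (κ p) ω ∂μ = ∫ ω, ∏ p, G p p.2 ω ∂μ := by
      intro N κ hκ
      have hσ : ∀ j, ∃ σ : Equiv.Perm ℕ, {k | σ k ≠ k}.Finite ∧
          ∀ (hj : j ∈ S) (i : Fin (nn j)), σ i = κ ⟨⟨j, hj⟩, i⟩ := by
        intro j
        by_cases hj : j ∈ S
        · obtain ⟨σ, hσ, hσ'⟩ := exists_finite_perm_extending (nn j)
            (fun i => if h : i < nn j then κ ⟨⟨j, hj⟩, ⟨i, h⟩⟩ else 0) (by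
              intro a ha b hb hab
              simp only [Set.mem_Iio] at ha hb
              simp only [ha, hb, dif_pos] at hab
              have h1 := Finset.mem_Ico.1 (hκ ⟨⟨j, hj⟩, ⟨a, ha⟩⟩)
              have h2 := Finset.mem_Ico.1 (hκ ⟨⟨j, hj⟩, ⟨b, hb⟩⟩)
              rw [hab] at h1
              have h3 := lt_of_mul_lt_mul_right (h1.1.trans_lt h2.2) N.zero_le
              have h4 := lt_of_mul_lt_mul_right (h2.1.trans_lt h1.2) N.zero_le
              simp only at h3 h4
              omega)
          exact ⟨σ, hσ, fun _ i => by rw [hσ' i i.2, dif_pos i.2]⟩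
        · exact ⟨1, by simp, fun h => absurd h hj⟩
      choose σ hσ hσ' using hσ
      have hΦ : Measurable fun x : ℕ × J → 𝕏 =>
          ∏ p : ι, (A p.2 p.1).indicator (fun _ => (1 : ℝ)) (x (p.2, p.1)) :=
        Finset.measurable_fun_prod _ fun p _ =>
          (measurable_const.indicator (hA p.2 p.1)).comp (measurable_pi_apply _)
      have h := congrArg (fun ρ : Measure (ℕ × J → 𝕏) => ∫ x, ∏ p : ι,
        (A p.2 p.1).indicator (fun _ => (1 : ℝ)) (x (p.2, p.1)) ∂ρ) (hpe σ hσ)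
      beta_reduce at h
      rw [integral_map (measurable_pi_lambda _ fun p => hX _ _).aemeasurable
          hΦ.aestronglyMeasurable,
        integral_map (measurable_pi_lambda _ fun p => hX _ _).aemeasurable
          hΦ.aestronglyMeasurable] at h
      rw [← h]
      congr 1; ext ω
      refine Finset.prod_congr rfl fun p _ => ?_
      simp only [G]
      rw [hσ' p.1 p.1.2 p.2]
    have hmain := integral_prod_limit_average hGm hG0 hG1 (fun p => (p.2 : ℕ)) hinv
      (L := fun p ω => (K p.1 fun i => X i p.1 ω).real (A p.2 p.1))
      (fun p => hfreq p.1 _ (hA p.2 p.1))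
    have hEm : MeasurableSet {ω | ∀ j ∈ S, ∀ i < nn j, X i j ω ∈ A i j} := by
      have : {ω | ∀ j ∈ S, ∀ i < nn j, X i j ω ∈ A i j}
          = ⋂ j ∈ S, ⋂ i ∈ Finset.range (nn j), X i j ⁻¹' A i j := by
        ext ω; simp
      rw [this]
      exact Finset.measurableSet_biInter _ fun j _ =>
        Finset.measurableSet_biInter _ fun i _ => hX i j (hA i j)
    have hleft : ∀ ω, ∏ p : ι, G p p.2 ω
        = {ω | ∀ j ∈ S, ∀ i < nn j, X i j ω ∈ A i j}.indicator (fun _ => (1 : ℝ)) ω := by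
      intro ω
      by_cases hω : ∀ j ∈ S, ∀ i < nn j, X i j ω ∈ A i j
      · rw [Set.indicator_of_mem (by exact hω)]
        exact Finset.prod_eq_one fun p _ =>
          Set.indicator_of_mem (hω p.1 p.1.2 p.2 p.2.2) _
      · rw [Set.indicator_of_notMem (by exact hω)]
        push Not at hω
        obtain ⟨j, hj, i, hi, hn⟩ := hω
        exact Finset.prod_eq_zero (Finset.mem_univ (⟨⟨j, hj⟩, ⟨i, hi⟩⟩ : ι))
          (Set.indicator_of_notMem hn _)
    have hright : ∀ ω, ∏ j ∈ S, ∏ i ∈ Finset.range (nn j), (K j fun i => X i j ω) (A i j)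
        = ENNReal.ofReal (∏ p : ι, (K p.1 fun i => X i p.1 ω).real (A p.2 p.1)) := by
      intro ω
      rw [ENNReal.ofReal_prod_of_nonneg fun p _ => measureReal_nonneg, Fintype.prod_sigma,
        ← Finset.prod_coe_sort]
      refine Finset.prod_congr rfl fun j _ => ?_
      rw [Finset.prod_range]
      refine Finset.prod_congr rfl fun i _ => ?_
      have := hKp j fun i => X i j ω
      rw [ofReal_measureReal]
    have hLm : ∀ p : ι, Measurable fun ω => (K p.1 fun i => X i p.1 ω).real (A p.2 p.1) :=
      fun p => ((Measure.measurable_coe (hA p.2 p.1)).comp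
        ((hKm p.1).comp (hcol p.1))).ennreal_toReal
    have hL1 : ∀ (p : ι) ω, (K p.1 fun i => X i p.1 ω).real (A p.2 p.1) ≤ 1 := fun p ω => by
      have := hKp p.1 fun i => X i p.1 ω
      exact measureReal_le_one
    simp_rw [hleft] at hmain
    simp_rw [hright]
    rw [← ofReal_integral_eq_lintegral_ofReal, hmain, integral_indicator hEm]
    · simp
    · refine Integrable.of_bound
        (Finset.measurable_fun_prod _ fun p _ => hLm p).aestronglyMeasurable 1
        (ae_of_all _ fun ω => ?_)
      rw [Real.norm_of_nonneg (Finset.prod_nonneg fun p _ => measureReal_nonneg)]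
      exact Finset.prod_le_one (fun p _ => measureReal_nonneg) fun p _ => hL1 p ω
    · exact ae_of_all _ fun ω => Finset.prod_nonneg fun p _ => measureReal_nonneg
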